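/- Let r ≥ 1 and let ℤʳ denote the free abelian group of rank r. Then ℤʳ has no proper elementarily embedded subgroups: if H ⪯ ℤʳ is an elementarily embedded subgroup, then H = ℤʳ. -/

import Mathlib

open FirstOrder

/-- Function symbols of the first-order language of groups:
one constant (identity), one unary symbol (inversion), one binary symbol (multiplication). -/
def groupFunctions : ℕ → Type
  | 0 => Unit
  | 1 => Unit
  | 2 => Unit
  | _ => Empty

/-- The first-order language of groups. -/
def groupLang : FirstOrder.Language where
  Functions := groupFunctions
  Relations := fun _ => Empty

/-- Any group is a structure for the language of groups, with the obvious interpretations. -/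
instance groupLangStructure (G : Type*) [Group G] : groupLang.Structure G where
  funMap := fun {n} f v =>
    match n, f, v with
    | 0, _, _ => (1 : G)
    | 1, _, v => (v 0)⁻¹
    | 2, _, v => v 0 * v 1
    | _ + 3, f, _ => f.elim
  RelMap := fun {_} r _ => r.elim

/-- A subgroup `H ≤ G` is elementarily embedded if every first-order formula with
parameters from `H` holds in `H` iff it holds in `G`. -/
def ElemEmbedded {G : Type*} [Group G] (H : Subgroup G) : Prop :=
  ∀ (n : ℕ) (φ : groupLang.Formula (Fin n)) (v : Fin n → H),
    φ.Realize v ↔ φ.Realize (fun i => (v i : G))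

/-- The term `t ^ k` in the language of groups. -/
def groupLangPow {α : Type*} (t : groupLang.Term α) : ℕ → groupLang.Term α
  | 0 => Language.Term.func (L := groupLang) (l := 0) () Fin.elim0
  | k + 1 => Language.Term.func (L := groupLang) (l := 2) () ![groupLangPow t k, t]

theorem realize_groupLangPow {G : Type*} [Group G] {α : Type*} (t : groupLang.Term α) (k : ℕ)
    (v : α → G) : (groupLangPow t k).realize v = t.realize v ^ k := by
  induction k with
  | zero => rw [pow_zero]; rfl
  | succ k ih => rw [pow_succ, ← ih]; rfl

/-- The formula stating that every element is the product of one of the parameters and a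
`k`-th power. -/
noncomputable def groupLangCosetCover (n k : ℕ) : groupLang.Formula (Fin n) :=
  Language.BoundedFormula.all <| Language.BoundedFormula.ex <|
    Language.BoundedFormula.iSup fun i : Fin n =>
      Language.Term.bdEqual (L := groupLang) (n := 2) (Language.Term.var (Sum.inr 0))
        (Language.Term.func (L := groupLang) (l := 2) ()
          ![Language.Term.var (Sum.inl i), groupLangPow (Language.Term.var (Sum.inr 1)) k])

theorem realize_groupLangCosetCover {G : Type*} [Group G] (n k : ℕ) (v : Fin n → G) :
    (groupLangCosetCover n k).Realize v ↔ ∀ y : G, ∃ z : G, ∃ i, y = v i * z ^ k := by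
  simp only [groupLangCosetCover, Language.Formula.Realize, Language.BoundedFormula.realize_all,
    Language.BoundedFormula.realize_ex, Language.BoundedFormula.realize_iSup,
    Language.BoundedFormula.realize_bdEqual]
  refine forall_congr' fun y => exists_congr fun z => exists_congr fun i => ?_
  rw [← show (groupLangPow (Language.Term.var (Sum.inr 1)) k).realize
    (Sum.elim v (Fin.snoc (Fin.snoc default y : Fin 1 → G) z : Fin 2 → G)) = z ^ k from
      realize_groupLangPow _ _ _]
  rfl

theorem ElemEmbedded.exists_mul_pow {G : Type*} [CommGroup G] {H : Subgroup G}
    (hH : ElemEmbedded H) [Group.FG H] {k : ℕ} (hk : 0 < k) (g : G) :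
    ∃ h ∈ H, ∃ z : G, g = h * z ^ k := by
  let P : Subgroup H := (powMonoidHom k).range
  have : Finite (H ⧸ P) :=
    CommGroup.finite_of_fg_isMulTorsion _
      (CommGroup.isMulTorsion_quotient_range_powMonoidHom H hk.ne')
  obtain ⟨n, ⟨e⟩⟩ := Finite.exists_equiv_fin (H ⧸ P)
  have hcover : (groupLangCosetCover n k).Realize fun i => (e.symm i).out := by
    rw [realize_groupLangCosetCover]
    intro y
    obtain ⟨z, hz⟩ := QuotientGroup.eq.1 (QuotientGroup.out_eq' (y : H ⧸ P))
    refine ⟨z, e y, ?_⟩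
    rw [Equiv.symm_apply_apply]
    exact eq_mul_of_inv_mul_eq hz.symm
  obtain ⟨z, i, hz⟩ := (realize_groupLangCosetCover _ _ _).1 ((hH _ _ _).1 hcover) g
  exact ⟨_, (e.symm i).out.2, z, hz⟩

theorem subsingleton_of_forall_surjective_nsmul {M : Type*} [AddCommGroup M] [Module.Finite ℤ M]
    (hM : ∀ k : ℕ, 0 < k → Function.Surjective fun x : M => k • x) : Subsingleton M := by
  obtain ⟨a, ha, haM⟩ := Submodule.exists_sub_one_mem_and_smul_eq_zero_of_fg_of_le_smul
    (Ideal.span {(2 : ℤ)}) (⊤ : Submodule ℤ M) Module.Finite.fg_top (fun x _ => by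
      obtain ⟨y, rfl⟩ := hM 2 two_pos x
      simpa [ofNat_smul_eq_nsmul] using Submodule.smul_mem_smul (N := (⊤ : Submodule ℤ M))
        (Ideal.mem_span_singleton_self (2 : ℤ)) (Submodule.mem_top (x := y)))
  rw [Ideal.mem_span_singleton] at ha
  refine subsingleton_of_forall_eq 0 fun x => ?_
  obtain ⟨y, rfl⟩ := hM a.natAbs (by omega) x
  have hy := haM y trivial
  change a.natAbs • y = 0
  rcases Int.natAbs_eq a with h | h <;> rw [h] at hy <;> simpa using hy

/-- For `r ≥ 1`, the free abelian group `ℤʳ` has no proper elementarily embedded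
subgroups: an elementarily embedded subgroup must be the whole group. -/
theorem free_abelian_no_proper_elemEmbedded (r : ℕ) (hr : 1 ≤ r)
    (H : Subgroup (Multiplicative (Fin r → ℤ))) (hH : ElemEmbedded H) :
    H = ⊤ := by
  let N : Submodule ℤ (Fin r → ℤ) := AddSubgroup.toIntSubmodule (Subgroup.toAddSubgroup' H)
  have : AddGroup.FG N := Module.Finite.iff_addGroup_fg.1 inferInstance
  have : Group.FG H := inferInstanceAs (Group.FG (Multiplicative N))
  have hN : Subsingleton ((Fin r → ℤ) ⧸ N) := by
    refine subsingleton_of_forall_surjective_nsmul fun k hk x => ?_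
    obtain ⟨g, rfl⟩ := N.mkQ_surjective x
    obtain ⟨h, hh, z, hz⟩ := hH.exists_mul_pow hk (Multiplicative.ofAdd g)
    refine ⟨N.mkQ z.toAdd, ?_⟩
    have hg : g = h.toAdd + k • z.toAdd := hz
    have h0 : N.mkQ h.toAdd = 0 := (Submodule.Quotient.mk_eq_zero N).2 hh
    simp only [hg, map_add, map_nsmul, h0, zero_add]
  rw [Submodule.Quotient.subsingleton_iff] at hN
  refine (Subgroup.eq_top_iff' H).2 fun x => ?_
  exact (hN ▸ Submodule.mem_top : x.toAdd ∈ N)
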